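/- arXiv:2401.12574 — 2 statements merged into one kernel-verified Lean document; each statement's English description precedes it below -/
import Mathlib

section
/- (Stochastic policy gradient theorem, finite version; Equation (11) of the proof of the conditional multi-agent policy gradient theorem.) For a parameterized policy (π_θ), the map θ ↦ V_{π_θ}(s) is differentiable for every state s, and its gradient satisfies ∇_θ V_{π_θ}(s) = ∑'_{t=0}^∞ γ^t ∑_{s'∈S} P(s→s',t,π_θ) ∑_{a∈A} ∇_θ π_θ(a|s') Q_{π_θ}(s',a), where the series on the right converges. -/
open scoped BigOperators Matrix

/-- The resolvent series `∑' t, γ ^ t • M ^ t` of a square matrix, computed entrywise. -/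
noncomputable def Matrix.discountedSum {n : Type*} [Fintype n] [DecidableEq n]
    (γ : ℝ) (M : Matrix n n ℝ) : Matrix n n ℝ :=
  Matrix.of fun i j => ∑' t : ℕ, γ ^ t * (M ^ t) i j

section DiscountedSum

variable {n : Type*} [Fintype n] [DecidableEq n] {γ : ℝ} {M : Matrix n n ℝ}

lemma Matrix.hasSum_discountedSum (hγ0 : 0 ≤ γ) (hγ1 : γ < 1)
    (hM : M ∈ Matrix.rowStochastic ℝ n) (i j : n) :
    HasSum (fun t : ℕ => γ ^ t * (M ^ t) i j) (M.discountedSum γ i j) := by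
  have hs : Summable (fun t : ℕ => γ ^ t * (M ^ t) i j) := by
    refine Summable.of_nonneg_of_le (fun t => ?_) (fun t => ?_)
      (summable_geometric_of_lt_one hγ0 hγ1)
    · exact mul_nonneg (pow_nonneg hγ0 t) (Matrix.nonneg_of_mem_rowStochastic (pow_mem hM t))
    · exact mul_le_of_le_one_right (pow_nonneg hγ0 t)
        (Matrix.le_one_of_mem_rowStochastic (pow_mem hM t))
  exact hs.hasSum

lemma Matrix.abs_discountedSum_le (hγ0 : 0 ≤ γ) (hγ1 : γ < 1)
    (hM : M ∈ Matrix.rowStochastic ℝ n) (i j : n) :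
    |M.discountedSum γ i j| ≤ (1 - γ)⁻¹ := by
  have h := Matrix.hasSum_discountedSum hγ0 hγ1 hM i j
  rw [abs_of_nonneg]
  · exact hasSum_le (fun t => mul_le_of_le_one_right (pow_nonneg hγ0 t)
      (Matrix.le_one_of_mem_rowStochastic (pow_mem hM t))) h
      (hasSum_geometric_of_lt_one hγ0 hγ1)
  · exact h.nonneg fun t =>
      mul_nonneg (pow_nonneg hγ0 t) (Matrix.nonneg_of_mem_rowStochastic (pow_mem hM t))

lemma Matrix.discountedSum_mul_one_sub (hγ0 : 0 ≤ γ) (hγ1 : γ < 1)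
    (hM : M ∈ Matrix.rowStochastic ℝ n) :
    M.discountedSum γ * (1 - γ • M) = 1 := by
  have key : M.discountedSum γ = 1 + γ • (M.discountedSum γ * M) := by
    ext i j
    have h := Matrix.hasSum_discountedSum hγ0 hγ1 hM
    have hsum : HasSum (fun t : ℕ => γ ^ (t + 1) * (M ^ (t + 1)) i j)
        (γ * ∑ k, M.discountedSum γ i k * M k j) := by
      have h2 := (hasSum_sum fun k (_ : k ∈ Finset.univ) =>
        (h i k).mul_right (M k j)).mul_left γ
      refine h2.congr_fun fun t => ?_
      rw [pow_succ M, Matrix.mul_apply, Finset.mul_sum, Finset.mul_sum]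
      exact Finset.sum_congr rfl fun k _ => by ring
    have h3 := (h i j).tsum_eq
    rw [(h i j).summable.tsum_eq_zero_add, hsum.tsum_eq] at h3
    simpa [Matrix.mul_apply] using h3.symm
  rw [mul_sub, mul_one, Matrix.mul_smul]
  nth_rewrite 1 [key]
  exact add_sub_cancel_right _ _

lemma Matrix.eq_discountedSum_mulVec_iff (hγ0 : 0 ≤ γ) (hγ1 : γ < 1)
    (hM : M ∈ Matrix.rowStochastic ℝ n) {x g : n → ℝ} :
    x = M.discountedSum γ *ᵥ g ↔ x = g + γ • M *ᵥ x := by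
  have h := Matrix.discountedSum_mul_one_sub hγ0 hγ1 hM
  have hx : (1 - γ • M) *ᵥ x = x - γ • M *ᵥ x := by
    rw [Matrix.sub_mulVec, Matrix.one_mulVec, Matrix.smul_mulVec]
  rw [← sub_eq_iff_eq_add, ← hx]
  constructor
  · rintro rfl
    rw [Matrix.mulVec_mulVec, mul_eq_one_comm.1 h, Matrix.one_mulVec]
  · rintro rfl
    rw [Matrix.mulVec_mulVec, h, Matrix.one_mulVec]

end DiscountedSum

/-- The product rule at a zero of `u` needs only continuity of the other factor `v`. -/
lemma HasFDerivAt.mul_continuousAt_of_eq_zero {E : Type*} [NormedAddCommGroup E] [NormedSpace ℝ E]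
    {u v : E → ℝ} {u' : E →L[ℝ] ℝ} {x : E} (hu : HasFDerivAt u u' x) (hux : u x = 0)
    (hv : ContinuousAt v x) : HasFDerivAt (fun y => u y * v y) (v x • u') x := by
  rw [hasFDerivAt_iff_isLittleO] at hu ⊢
  have hv0 : (fun y => v y - v x) =o[nhds x] fun _ => (1 : ℝ) := by
    rw [Asymptotics.isLittleO_one_iff]
    simpa using hv.tendsto.sub_const (v x)
  have h1 := (hv.tendsto.isBigO_one ℝ).mul_isLittleO hu.norm_right
  have h2 := hv0.mul_isBigO (u'.isBigO_sub (nhds x) x).norm_right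
  simp only [one_mul] at h1 h2
  refine ((h1.add h2).congr_left fun y => ?_).of_norm_right
  simp only [hux, smul_apply, smul_eq_mul]
  ring

section Policy

variable {S A : Type*} [Fintype S] [Fintype A]

/-- The state transition matrix induced by a transition kernel and a policy. -/
def policyTransition (P : S → A → S → ℝ) (p : S → A → ℝ) : Matrix S S ℝ :=
  Matrix.of fun s s' => ∑ a, p s a * P s a s'

lemma policyTransition_mem_rowStochastic [DecidableEq S] {P : S → A → S → ℝ} {p : S → A → ℝ}
    (hP0 : ∀ s a s', 0 ≤ P s a s') (hP1 : ∀ s a, ∑ s', P s a s' = 1)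
    (hp0 : ∀ s a, 0 ≤ p s a) (hp1 : ∀ s, ∑ a, p s a = 1) :
    policyTransition P p ∈ Matrix.rowStochastic ℝ S := by
  rw [Matrix.mem_rowStochastic_iff_sum]
  refine ⟨fun s s' => Finset.sum_nonneg fun a _ => mul_nonneg (hp0 s a) (hP0 s a s'), fun s => ?_⟩
  simp only [policyTransition, Matrix.of_apply]
  rw [Finset.sum_comm]
  simp [← Finset.mul_sum, hP1, hp1]

/-- The performance difference identity for two solutions of Bellman equations. -/
lemma sub_eq_discountedSum_mulVec [DecidableEq S] {P : S → A → S → ℝ} {r : S → A → ℝ} {γ : ℝ}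
    (hγ0 : 0 ≤ γ) (hγ1 : γ < 1) {p p' : S → A → ℝ} {v v' : S → ℝ}
    (hM : policyTransition P p ∈ Matrix.rowStochastic ℝ S)
    (hv : ∀ s, v s = ∑ a, p s a * (r s a + γ * ∑ s', P s a s' * v s'))
    (hv' : ∀ s, v' s = ∑ a, p' s a * (r s a + γ * ∑ s', P s a s' * v' s')) :
    v' - v = (policyTransition P p).discountedSum γ *ᵥ
      fun s => ∑ a, (p' s a - p s a) * (r s a + γ * ∑ s', P s a s' * v' s') := by
  rw [Matrix.eq_discountedSum_mulVec_iff hγ0 hγ1 hM]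
  ext s
  have h : (policyTransition P p *ᵥ (v' - v)) s =
      ∑ a, p s a * (∑ s', P s a s' * v' s' - ∑ s', P s a s' * v s') := by
    simp only [policyTransition, Matrix.mulVec, dotProduct, Matrix.of_apply, Finset.sum_mul,
      Pi.sub_apply, ← Finset.sum_sub_distrib, Finset.mul_sum]
    rw [Finset.sum_comm]
    exact Finset.sum_congr rfl fun a _ => Finset.sum_congr rfl fun s' _ => by ring
  rw [Pi.add_apply, Pi.smul_apply, h, Pi.sub_apply, hv s, hv' s, smul_eq_mul, Finset.mul_sum,
    ← Finset.sum_sub_distrib, ← Finset.sum_add_distrib]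
  exact Finset.sum_congr rfl fun a _ => by ring

end Policy

/-- Stochastic policy gradient theorem (finite version): for a
parameterized policy `π θ`, the map `θ ↦ V θ s` is differentiable for every state `s`,
and its gradient is `∑' t, γ ^ t • ∑ s', T θ t s s' • ∑ a, Q θ s' a • ∇_θ π θ (a|s')`,
where the series on the right converges. -/
theorem stochastic_policy_gradient_theorem
    {S A : Type*} [Fintype S] [Nonempty S] [DecidableEq S]
    [Fintype A] [Nonempty A] {d : ℕ}
    (P : S → A → S → ℝ)
    (hP0 : ∀ s a s', 0 ≤ P s a s')
    (hP1 : ∀ s a, ∑ s', P s a s' = 1)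
    (r : S → A → ℝ)
    (γ : ℝ) (hγ0 : 0 ≤ γ) (hγ1 : γ < 1)
    -- the parameterized policy π_θ
    (π : (Fin d → ℝ) → S → A → ℝ)
    (hπ0 : ∀ θ s a, 0 ≤ π θ s a)
    (hπ1 : ∀ θ s, ∑ a, π θ s a = 1)
    (hπC1 : ∀ s a, ContDiff ℝ 1 (fun θ : Fin d → ℝ => π θ s a))
    -- the t-step state distribution P(s → s', t, π_θ)
    (T : (Fin d → ℝ) → ℕ → S → S → ℝ)
    (hT0 : ∀ θ s s', T θ 0 s s' = if s' = s then 1 else 0)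
    (hTsucc : ∀ θ t s s'',
      T θ (t + 1) s s'' = ∑ s', T θ t s s' * ∑ a, π θ s' a * P s' a s'')
    -- the value function V_{π_θ}
    (V : (Fin d → ℝ) → S → ℝ)
    (hV : ∀ θ s, V θ s = ∑' t : ℕ, γ ^ t * ∑ s', T θ t s s' * ∑ a, π θ s' a * r s' a)
    -- the action-value function Q_{π_θ}
    (Q : (Fin d → ℝ) → S → A → ℝ)
    (hQ : ∀ θ s a, Q θ s a = r s a + γ * ∑ s', P s a s' * V θ s') :
    (∀ (s : S) (θ : Fin d → ℝ), Summable (fun t : ℕ =>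
      γ ^ t • ∑ s', T θ t s s' •
        ∑ a, Q θ s' a • fderiv ℝ (fun θ' : Fin d → ℝ => π θ' s' a) θ)) ∧
    (∀ (s : S) (θ : Fin d → ℝ), HasFDerivAt (fun θ' : Fin d → ℝ => V θ' s)
      (∑' t : ℕ, γ ^ t • ∑ s', T θ t s s' •
        ∑ a, Q θ s' a • fderiv ℝ (fun θ' : Fin d → ℝ => π θ' s' a) θ) θ) := by
  have hM : ∀ θ, policyTransition P (π θ) ∈ Matrix.rowStochastic ℝ S := fun θ =>
    policyTransition_mem_rowStochastic hP0 hP1 (hπ0 θ) (hπ1 θ)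
  have hT : ∀ θ t s s', T θ t s s' = (policyTransition P (π θ) ^ t) s s' := by
    intro θ t
    induction t with
    | zero => intro s s'; simp [hT0, Matrix.one_apply, eq_comm]
    | succ t ih =>
      intro s s'
      rw [hTsucc, pow_succ, Matrix.mul_apply]
      simp [ih, policyTransition]
  set N : (Fin d → ℝ) → Matrix S S ℝ := fun θ => (policyTransition P (π θ)).discountedSum γ
  have hN : ∀ θ s s', HasSum (fun t : ℕ => γ ^ t * T θ t s s') (N θ s s') := fun θ s s' => by
    simpa only [hT] using Matrix.hasSum_discountedSum hγ0 hγ1 (hM θ) s s'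
  have hVN : ∀ θ, V θ = N θ *ᵥ fun s => ∑ a, π θ s a * r s a := by
    intro θ
    ext s
    rw [hV]
    refine HasSum.tsum_eq ?_
    refine (hasSum_sum fun s' (_ : s' ∈ Finset.univ) =>
      (hN θ s s').mul_right (∑ a, π θ s' a * r s' a)).congr_fun fun t => ?_
    rw [Finset.mul_sum]
    exact Finset.sum_congr rfl fun s' _ => (mul_assoc _ _ _).symm
  have hBellman : ∀ θ s, V θ s = ∑ a, π θ s a * (r s a + γ * ∑ s', P s a s' * V θ s') := by
    intro θ s
    have h := congrFun ((Matrix.eq_discountedSum_mulVec_iff hγ0 hγ1 (hM θ)).1 (hVN θ)) s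
    rw [h]
    simp only [Pi.add_apply, Pi.smul_apply, policyTransition, Matrix.mulVec, dotProduct,
      Matrix.of_apply, smul_eq_mul, mul_add, Finset.sum_add_distrib, Finset.sum_mul,
      Finset.mul_sum]
    congr 1
    rw [Finset.sum_comm]
    exact Finset.sum_congr rfl fun a _ => Finset.sum_congr rfl fun s' _ => by ring
  have hdiff : ∀ θ θ' s, V θ' s = V θ s +
      ∑ s', N θ s s' * ∑ a, (π θ' s' a - π θ s' a) * Q θ' s' a := by
    intro θ θ' s
    have h := congrFun (sub_eq_discountedSum_mulVec hγ0 hγ1 (hM θ) (hBellman θ) (hBellman θ')) s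
    rw [← sub_eq_iff_eq_add']
    simp only [hQ]
    exact h
  have hVbound : ∀ s, ∃ C, ∀ θ, |V θ s| ≤ C := by
    intro s
    refine ⟨∑ s', (1 - γ)⁻¹ * ∑ a, |r s' a|, fun θ => ?_⟩
    rw [hVN]
    refine (Finset.abs_sum_le_sum_abs _ _).trans (Finset.sum_le_sum fun s' _ => ?_)
    rw [abs_mul]
    refine mul_le_mul (Matrix.abs_discountedSum_le hγ0 hγ1 (hM θ) s s') ?_ (abs_nonneg _)
      (inv_nonneg.2 (sub_nonneg.2 hγ1.le))
    refine (Finset.abs_sum_le_sum_abs _ _).trans (Finset.sum_le_sum fun a _ => ?_)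
    rw [abs_mul, abs_of_nonneg (hπ0 θ s' a)]
    refine mul_le_of_le_one_left (abs_nonneg _) ?_
    rw [← hπ1 θ s']
    exact Finset.single_le_sum (fun b _ => hπ0 θ s' b) (Finset.mem_univ a)
  choose C hC using hVbound
  have hQbound : ∀ s a θ, |Q θ s a| ≤ |r s a| + γ * ∑ s', P s a s' * C s' := by
    intro s a θ
    rw [hQ]
    refine (abs_add_le _ _).trans (add_le_add le_rfl ?_)
    rw [abs_mul, abs_of_nonneg hγ0]
    refine mul_le_mul_of_nonneg_left ?_ hγ0
    refine (Finset.abs_sum_le_sum_abs _ _).trans (Finset.sum_le_sum fun s' _ => ?_)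
    rw [abs_mul, abs_of_nonneg (hP0 s a s')]
    exact mul_le_mul_of_nonneg_left (hC s' θ) (hP0 s a s')
  have hVcont : ∀ s θ, ContinuousAt (fun θ' => V θ' s) θ := by
    intro s θ
    have hterm : ∀ s' a, Filter.Tendsto (fun θ' => (π θ' s' a - π θ s' a) * Q θ' s' a)
        (nhds θ) (nhds 0) := by
      intro s' a
      have h0 : Filter.Tendsto (fun θ' => π θ' s' a - π θ s' a) (nhds θ) (nhds 0) := by
        simpa using ((hπC1 s' a).continuous.tendsto θ).sub_const (π θ s' a)
      simpa only [mul_comm] using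
        bdd_le_mul_tendsto_zero' _ (Filter.Eventually.of_forall (hQbound s' a)) h0
    have h := tendsto_finsetSum Finset.univ fun s' _ =>
      (tendsto_finsetSum Finset.univ fun a _ => hterm s' a).const_mul (N θ s s')
    have h' := h.const_add (V θ s)
    simp only [Finset.sum_const_zero, mul_zero, add_zero, ← hdiff] at h'
    exact h'
  have hQcont : ∀ s a θ, ContinuousAt (fun θ' => Q θ' s a) θ := by
    intro s a θ
    simp only [hQ]
    exact continuousAt_const.add (continuousAt_const.mul
      (tendsto_finsetSum Finset.univ fun s' _ => (hVcont s' θ).const_mul (P s a s')))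
  have hgrad : ∀ s θ, HasSum (fun t : ℕ => γ ^ t • ∑ s', T θ t s s' •
      ∑ a, Q θ s' a • fderiv ℝ (fun θ' : Fin d → ℝ => π θ' s' a) θ)
      (∑ s', N θ s s' • ∑ a, Q θ s' a • fderiv ℝ (fun θ' : Fin d → ℝ => π θ' s' a) θ) := by
    intro s θ
    refine (hasSum_sum fun s' (_ : s' ∈ Finset.univ) => (hN θ s s').smul_const
      (∑ a, Q θ s' a • fderiv ℝ (fun θ' : Fin d → ℝ => π θ' s' a) θ)).congr_fun fun t => ?_
    rw [Finset.smul_sum]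
    exact Finset.sum_congr rfl fun s' _ => smul_smul _ _ _
  refine ⟨fun s θ => (hgrad s θ).summable, fun s θ => ?_⟩
  rw [(hgrad s θ).tsum_eq]
  rw [funext fun θ' => hdiff θ θ' s]
  refine HasFDerivAt.const_add _ (HasFDerivAt.fun_sum fun s' _ =>
    HasFDerivAt.const_mul (HasFDerivAt.fun_sum fun a _ => ?_) _)
  exact HasFDerivAt.mul_continuousAt_of_eq_zero
    (((hπC1 s' a).differentiable one_ne_zero θ).hasFDerivAt.sub_const _) (sub_self _)
    (hQcont s' a θ)
end

section
/- (Own-learning term of the Conditional Multi-Agent Stochastic Policy Gradient Theorem, exact discrete-action case.) Suppose the joint policy is auto-regressive with forward-dependency sets F_i ⊆ {1,…,i−1}: π_θ(a|s) = ∏_{i=1}^n π_{θ_i}(a^i | s, a^{F_i}), where for each agent i, each state s, and each tuple of preceding actions a^{F_i}, π_{θ_i}(·|s,a^{F_i}) is a probability mass function on A_i and θ_i ↦ π_{θ_i}(a^i|s,a^{F_i}) is continuously differentiable. Then for each agent i the objective J is differentiable in θ_i and ∇_{θ_i} J(θ) = ∑_{s∈S} ρ^{π_θ}(s) ∑_{a∈A}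 ∇_{θ_i} π_{θ_i}(a^i|s,a^{F_i}) · ∏_{j≠i} π_{θ_j}(a^j|s,a^{F_j}) · Q_{π_θ}(s,a); in particular, with discrete actions and no reparameterization of actions, the peer-learning term of the theorem vanishes and only the own-learning term remains. -/
open scoped BigOperators

/-- A product of conditional probability mass functions, the `i`-th of which depends only on the
coordinates before `i`, sums to one. -/
theorem sum_prod_conditional_eq_one {n : ℕ} (α : Fin n → Type*) [∀ i, Fintype (α i)]
    [∀ i, Nonempty (α i)] (f : ∀ i, (∀ j, α j) → α i → ℝ)
    (hdep : ∀ i (a a' : ∀ j, α j) b, (∀ j < i, a j = a' j) → f i a b = f i a' b)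
    (hsum : ∀ i a, ∑ b, f i a b = 1) :
    ∑ a : ∀ i, α i, ∏ i, f i a (a i) = 1 := by
  induction n with
  | zero => simp
  | succ n ih =>
    obtain ⟨b₀⟩ : Nonempty (α (Fin.last n)) := inferInstance
    rw [← (Fin.snocEquiv α).sum_comp, Fintype.sum_prod_type_right]
    have hinit : ∀ (c : ∀ i : Fin n, α i.castSucc) (b : α (Fin.last n)) (i : Fin n)
        (e : α i.castSucc),
        f i.castSucc (Fin.snoc c b) e = f i.castSucc (Fin.snoc c b₀) e := by
      intro c b i e
      refine hdep _ _ _ _ fun j hj => ?_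
      obtain ⟨k, rfl⟩ := Fin.exists_castSucc_eq.2 (ne_of_lt (hj.trans (Fin.castSucc_lt_last i)))
      simp
    have hlast : ∀ (c : ∀ i : Fin n, α i.castSucc) (b e : α (Fin.last n)),
        f (Fin.last n) (Fin.snoc c b) e = f (Fin.last n) (Fin.snoc c b₀) e := by
      intro c b e
      refine hdep _ _ _ _ fun j hj => ?_
      obtain ⟨k, rfl⟩ := Fin.exists_castSucc_eq.2 (ne_of_lt hj)
      simp
    have hfac : ∀ c : ∀ i : Fin n, α i.castSucc,
        ∑ b, ∏ i, f i (Fin.snoc c b) (Fin.snoc (α := α) c b i) =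
          ∏ i : Fin n, f i.castSucc (Fin.snoc c b₀) (c i) := by
      intro c
      simp only [Fin.prod_univ_castSucc, Fin.snoc_castSucc, Fin.snoc_last, hinit, hlast]
      rw [← Finset.mul_sum, hsum, mul_one]
    refine (Finset.sum_congr rfl fun c _ => hfac c).trans ?_
    refine ih (fun i => α i.castSucc) (fun i c e => f i.castSucc (Fin.snoc c b₀) e) ?_ ?_
    · intro i c c' e h
      refine hdep _ _ _ _ fun j hj => ?_
      obtain ⟨k, rfl⟩ := Fin.exists_castSucc_eq.2 (ne_of_lt (hj.trans (Fin.castSucc_lt_last i)))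
      simpa using h k (by simpa using hj)
    · intro i c
      exact hsum _ _

section Resolvent

variable {S : Type*} [Fintype S] [DecidableEq S]

theorem iterate_stochastic_nonneg {K : S → S → ℝ} (hK0 : ∀ s s', 0 ≤ K s s')
    {T : ℕ → S → S → ℝ} (hT0 : ∀ s s', T 0 s s' = if s' = s then 1 else 0)
    (hTs : ∀ t s s'', T (t + 1) s s'' = ∑ s', T t s s' * K s' s'') (t : ℕ) (s s' : S) :
    0 ≤ T t s s' := by
  induction t generalizing s' with
  | zero => rw [hT0]; split_ifs <;> norm_num
  | succ t ih => rw [hTs]; exact Finset.sum_nonneg fun k _ => mul_nonneg (ih k) (hK0 k s')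

theorem sum_iterate_stochastic {K : S → S → ℝ} (hK1 : ∀ s, ∑ s', K s s' = 1)
    {T : ℕ → S → S → ℝ} (hT0 : ∀ s s', T 0 s s' = if s' = s then 1 else 0)
    (hTs : ∀ t s s'', T (t + 1) s s'' = ∑ s', T t s s' * K s' s'') (t : ℕ) (s : S) :
    ∑ s', T t s s' = 1 := by
  induction t with
  | zero => simp [hT0]
  | succ t ih =>
    simp only [hTs]
    rw [Finset.sum_comm]
    simp only [← Finset.mul_sum, hK1, mul_one, ih]

theorem iterate_stochastic_le_one {K : S → S → ℝ} (hK0 : ∀ s s', 0 ≤ K s s')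
    (hK1 : ∀ s, ∑ s', K s s' = 1)
    {T : ℕ → S → S → ℝ} (hT0 : ∀ s s', T 0 s s' = if s' = s then 1 else 0)
    (hTs : ∀ t s s'', T (t + 1) s s'' = ∑ s', T t s s' * K s' s'') (t : ℕ) (s s' : S) :
    T t s s' ≤ 1 := by
  rw [← sum_iterate_stochastic hK1 hT0 hTs t s]
  exact Finset.single_le_sum (fun k _ => iterate_stochastic_nonneg hK0 hT0 hTs t s k)
    (Finset.mem_univ s')

theorem norm_discounted_iterate_le {K : S → S → ℝ} (hK0 : ∀ s s', 0 ≤ K s s')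
    (hK1 : ∀ s, ∑ s', K s s' = 1)
    {T : ℕ → S → S → ℝ} (hT0 : ∀ s s', T 0 s s' = if s' = s then 1 else 0)
    (hTs : ∀ t s s'', T (t + 1) s s'' = ∑ s', T t s s' * K s' s'')
    {γ : ℝ} (hγ0 : 0 ≤ γ) (t : ℕ) (s s' : S) :
    ‖γ ^ t * T t s s'‖ ≤ γ ^ t := by
  have h0 := iterate_stochastic_nonneg hK0 hT0 hTs t s s'
  have hγ := pow_nonneg hγ0 t
  rw [Real.norm_of_nonneg (mul_nonneg hγ h0)]
  exact mul_le_of_le_one_right hγ (iterate_stochastic_le_one hK0 hK1 hT0 hTs t s s')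

theorem summable_discounted_iterate {K : S → S → ℝ} (hK0 : ∀ s s', 0 ≤ K s s')
    (hK1 : ∀ s, ∑ s', K s s' = 1)
    {T : ℕ → S → S → ℝ} (hT0 : ∀ s s', T 0 s s' = if s' = s then 1 else 0)
    (hTs : ∀ t s s'', T (t + 1) s s'' = ∑ s', T t s s' * K s' s'')
    {γ : ℝ} (hγ0 : 0 ≤ γ) (hγ1 : γ < 1) (s s' : S) :
    Summable fun t : ℕ => γ ^ t * T t s s' :=
  (summable_geometric_of_lt_one hγ0 hγ1).of_norm_bounded
    fun t => norm_discounted_iterate_le hK0 hK1 hT0 hTs hγ0 t s s'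

/-- The discounted visitation matrix is a left inverse of `1 - γ K`. -/
theorem visitation_mul_one_sub {K : S → S → ℝ} (hK0 : ∀ s s', 0 ≤ K s s')
    (hK1 : ∀ s, ∑ s', K s s' = 1)
    {T : ℕ → S → S → ℝ} (hT0 : ∀ s s', T 0 s s' = if s' = s then 1 else 0)
    (hTs : ∀ t s s'', T (t + 1) s s'' = ∑ s', T t s s' * K s' s'')
    {γ : ℝ} (hγ0 : 0 ≤ γ) (hγ1 : γ < 1) :
    (Matrix.of fun s s' => ∑' t : ℕ, γ ^ t * T t s s') * (1 - γ • Matrix.of K) = 1 := by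
  have hsm := summable_discounted_iterate hK0 hK1 hT0 hTs hγ0 hγ1
  rw [mul_sub, mul_one, sub_eq_iff_eq_add]
  ext s s''
  simp only [Matrix.of_apply, Matrix.add_apply, Matrix.mul_apply, Matrix.smul_apply, smul_eq_mul,
    Matrix.one_apply]
  rw [(hsm s s'').tsum_eq_zero_add, pow_zero, one_mul, hT0]
  congr 1
  · simp only [eq_comm]
  · simp only [← tsum_mul_right]
    rw [← Summable.tsum_finsetSum fun k _ => (hsm s k).mul_right _]
    refine tsum_congr fun t => ?_
    rw [hTs, Finset.mul_sum]
    refine Finset.sum_congr rfl fun k _ => ?_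
    ring

theorem discounted_value_eq_mulVec {K : S → S → ℝ} (hK0 : ∀ s s', 0 ≤ K s s')
    (hK1 : ∀ s, ∑ s', K s s' = 1)
    {T : ℕ → S → S → ℝ} (hT0 : ∀ s s', T 0 s s' = if s' = s then 1 else 0)
    (hTs : ∀ t s s'', T (t + 1) s s'' = ∑ s', T t s s' * K s' s'')
    {γ : ℝ} (hγ0 : 0 ≤ γ) (hγ1 : γ < 1) (R : S → ℝ) :
    (fun s => ∑' t : ℕ, γ ^ t * ∑ s', T t s s' * R s') =
      (Matrix.of fun s s' => ∑' t : ℕ, γ ^ t * T t s s').mulVec R := by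
  have hsm := summable_discounted_iterate hK0 hK1 hT0 hTs hγ0 hγ1
  ext s
  simp only [Matrix.mulVec, dotProduct, Matrix.of_apply, ← tsum_mul_right]
  rw [← Summable.tsum_finsetSum fun k _ => (hsm s k).mul_right _]
  simp only [Finset.mul_sum, mul_assoc]

/-- The difference of the discounted value and an arbitrary function `W` is the discounted
accumulation of the Bellman residual of `W`. -/
theorem discounted_value_sub {K : S → S → ℝ} (hK0 : ∀ s s', 0 ≤ K s s')
    (hK1 : ∀ s, ∑ s', K s s' = 1)
    {T : ℕ → S → S → ℝ} (hT0 : ∀ s s', T 0 s s' = if s' = s then 1 else 0)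
    (hTs : ∀ t s s'', T (t + 1) s s'' = ∑ s', T t s s' * K s' s'')
    {γ : ℝ} (hγ0 : 0 ≤ γ) (hγ1 : γ < 1) (R W : S → ℝ) (s : S) :
    (∑' t : ℕ, γ ^ t * ∑ s', T t s s' * R s') - W s =
      ∑ s', (∑' t : ℕ, γ ^ t * T t s s') * (R s' + γ * ∑ s'', K s' s'' * W s'' - W s') := by
  set D : Matrix S S ℝ := Matrix.of fun s s' => ∑' t : ℕ, γ ^ t * T t s s' with hD
  have hval := discounted_value_eq_mulVec hK0 hK1 hT0 hTs hγ0 hγ1 R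
  have hinv : D * (1 - γ • Matrix.of K) = 1 :=
    visitation_mul_one_sub hK0 hK1 hT0 hTs hγ0 hγ1
  have hres : (fun s' => R s' + γ * ∑ s'', K s' s'' * W s'' - W s') =
      R - (1 - γ • Matrix.of K).mulVec W := by
    rw [Matrix.sub_mulVec, Matrix.one_mulVec, Matrix.smul_mulVec]
    ext k
    simp only [Pi.sub_apply, Pi.smul_apply, Matrix.mulVec, dotProduct, Matrix.of_apply, smul_eq_mul]
    ring
  have key : D.mulVec (fun s' => R s' + γ * ∑ s'', K s' s'' * W s'' - W s') =
      D.mulVec R - W := by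
    rw [hres, Matrix.mulVec_sub, Matrix.mulVec_mulVec, hinv, Matrix.one_mulVec]
  have := congrFun key s
  rw [← hval] at this
  exact this.symm

theorem discounted_value_bellman {K : S → S → ℝ} (hK0 : ∀ s s', 0 ≤ K s s')
    (hK1 : ∀ s, ∑ s', K s s' = 1)
    {T : ℕ → S → S → ℝ} (hT0 : ∀ s s', T 0 s s' = if s' = s then 1 else 0)
    (hTs : ∀ t s s'', T (t + 1) s s'' = ∑ s', T t s s' * K s' s'')
    {γ : ℝ} (hγ0 : 0 ≤ γ) (hγ1 : γ < 1) (R V : S → ℝ)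
    (hV : ∀ s, V s = ∑' t : ℕ, γ ^ t * ∑ s', T t s s' * R s') (s : S) :
    V s = R s + γ * ∑ s', K s s' * V s' := by
  have hinv := mul_eq_one_comm.1 (visitation_mul_one_sub hK0 hK1 hT0 hTs hγ0 hγ1)
  have hval : V = _ := (funext hV).trans (discounted_value_eq_mulVec hK0 hK1 hT0 hTs hγ0 hγ1 R)
  have key : (1 - γ • Matrix.of K).mulVec V = R := by
    rw [hval, Matrix.mulVec_mulVec, hinv, Matrix.one_mulVec]
  rw [Matrix.sub_mulVec, Matrix.one_mulVec, Matrix.smul_mulVec] at key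
  have := congrFun key s
  simp only [Pi.sub_apply, Pi.smul_apply, Matrix.mulVec, dotProduct, Matrix.of_apply,
    smul_eq_mul] at this
  linarith

end Resolvent

/-- A product whose second factor vanishes at `x₀` is differentiable there as soon as the first
factor is continuous. -/
theorem ContinuousAt.hasFDerivAt_mul_of_eq_zero {E : Type*} [NormedAddCommGroup E]
    [NormedSpace ℝ E] {c g : E → ℝ} {g' : E →L[ℝ] ℝ} {x₀ : E} (hc : ContinuousAt c x₀)
    (hg : HasFDerivAt g g' x₀) (hg0 : g x₀ = 0) :
    HasFDerivAt (fun x => c x * g x) (c x₀ • g') x₀ := by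
  have hO : g =O[nhds x₀] fun x => x - x₀ := by simpa [hg0] using hg.isBigO_sub
  have ho : (fun x => c x - c x₀) =o[nhds x₀] fun _ => (1 : ℝ) := by
    rw [Asymptotics.isLittleO_one_iff]
    simpa using hc.sub_const (c x₀)
  have h1 : HasFDerivAt (fun x => (c x - c x₀) * g x) (0 : E →L[ℝ] ℝ) x₀ := by
    refine HasFDerivAt.of_isLittleO ?_
    simpa [hg0] using (ho.mul_isBigO hO.norm_right).norm_right
  have h2 := h1.add (hg.const_mul (c x₀))
  rw [zero_add] at h2
  refine h2.congr_of_eventuallyEq (Filter.Eventually.of_forall fun x => ?_)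
  simp only [Pi.add_apply]
  ring

/-- The policy gradient theorem for a finite discounted Markov decision process. -/
theorem hasFDerivAt_policy_objective {S A E : Type*} [Fintype S] [DecidableEq S] [Fintype A]
    [NormedAddCommGroup E] [NormedSpace ℝ E]
    (P : S → A → S → ℝ) (hP0 : ∀ s a s', 0 ≤ P s a s') (hP1 : ∀ s a, ∑ s', P s a s' = 1)
    (r : S → A → ℝ) (γ : ℝ) (hγ0 : 0 ≤ γ) (hγ1 : γ < 1)
    (p : E → S → A → ℝ) (hp0 : ∀ x s a, 0 ≤ p x s a) (hp1 : ∀ x s, ∑ a, p x s a = 1)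
    (hpc : ∀ s a, Continuous fun x => p x s a)
    (T : E → ℕ → S → S → ℝ) (hT0 : ∀ x s s', T x 0 s s' = if s' = s then 1 else 0)
    (hTs : ∀ x t s s'', T x (t + 1) s s'' = ∑ s', T x t s s' * ∑ a, p x s' a * P s' a s'')
    (V : E → S → ℝ)
    (hV : ∀ x s, V x s = ∑' t : ℕ, γ ^ t * ∑ s', T x t s s' * ∑ a, p x s' a * r s' a)
    (ρ0 : S → ℝ) (x₀ : E) (p' : S → A → E →L[ℝ] ℝ)
    (hp' : ∀ s a, HasFDerivAt (fun x => p x s a) (p' s a) x₀) :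
    HasFDerivAt (fun x => ∑ s, ρ0 s * V x s)
      (∑ s, (∑ s0, ρ0 s0 * ∑' t : ℕ, γ ^ t * T x₀ t s0 s) •
        ∑ a, (r s a + γ * ∑ s', P s a s' * V x₀ s') • p' s a) x₀ := by
  have hK0 : ∀ x s s', 0 ≤ ∑ a, p x s a * P s a s' := fun x s s' =>
    Finset.sum_nonneg fun a _ => mul_nonneg (hp0 x s a) (hP0 s a s')
  have hK1 : ∀ x s, ∑ s', ∑ a, p x s a * P s a s' = 1 := fun x s => by
    rw [Finset.sum_comm]
    simp only [← Finset.mul_sum, hP1, mul_one, hp1]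
  have hTc : ∀ t s s', Continuous fun x => T x t s s' := by
    intro t
    induction t with
    | zero => intro s s'; simp only [hT0]; exact continuous_const
    | succ t ih =>
      intro s s'
      simp only [hTs]
      exact continuous_finsetSum _ fun k _ => (ih s k).mul
        (continuous_finsetSum _ fun a _ => (hpc k a).mul continuous_const)
  have hDc : ∀ s, Continuous fun x => ∑ s0, ρ0 s0 * ∑' t : ℕ, γ ^ t * T x t s0 s := fun s =>
    continuous_finsetSum _ fun s0 _ => continuous_const.mul <|
      continuous_tsum (fun t => continuous_const.mul (hTc t s0 s))
        (summable_geometric_of_lt_one hγ0 hγ1) fun t x =>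
          norm_discounted_iterate_le (hK0 x) (hK1 x) (hT0 x) (hTs x) hγ0 t s0 s
  have hres : ∀ x s, ∑ a, p x s a * (r s a + γ * ∑ s', P s a s' * V x₀ s') =
      ∑ a, p x s a * r s a + γ * ∑ s', (∑ a, p x s a * P s a s') * V x₀ s' := by
    intro x s
    simp only [mul_add, Finset.sum_add_distrib, Finset.mul_sum, Finset.sum_mul]
    congr 1
    rw [Finset.sum_comm]
    refine Finset.sum_congr rfl fun k _ => Finset.sum_congr rfl fun a _ => ?_
    ring
  have hzero : ∀ s,
      ∑ a, p x₀ s a * (r s a + γ * ∑ s', P s a s' * V x₀ s') - V x₀ s = 0 := by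
    intro s
    rw [hres, sub_eq_zero]
    exact (discounted_value_bellman (hK0 x₀) (hK1 x₀) (hT0 x₀) (hTs x₀) hγ0 hγ1
      (fun s' => ∑ a, p x₀ s' a * r s' a) (V x₀) (hV x₀) s).symm
  have hdiff : ∀ x, ∑ s, ρ0 s * V x s = (∑ s, (∑ s0, ρ0 s0 * ∑' t : ℕ, γ ^ t * T x t s0 s) *
      (∑ a, p x s a * (r s a + γ * ∑ s', P s a s' * V x₀ s') - V x₀ s)) +
        ∑ s, ρ0 s * V x₀ s := by
    intro x
    rw [← sub_eq_iff_eq_add, ← Finset.sum_sub_distrib]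
    simp only [← mul_sub, hres, Finset.sum_mul]
    rw [Finset.sum_comm]
    refine Finset.sum_congr rfl fun s _ => ?_
    rw [hV x s, discounted_value_sub (hK0 x) (hK1 x) (hT0 x) (hTs x) hγ0 hγ1
      (fun s' => ∑ a, p x s' a * r s' a) (V x₀) s, Finset.mul_sum]
    simp only [Finset.sum_mul, mul_assoc]
  rw [funext hdiff]
  refine HasFDerivAt.add_const _ (HasFDerivAt.fun_sum fun s _ => ?_)
  refine (hDc s).continuousAt.hasFDerivAt_mul_of_eq_zero ?_ (hzero s)
  exact (HasFDerivAt.fun_sum fun a _ => (hp' s a).mul_const _).sub_const _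

/-- Own-learning term of the Conditional Multi-Agent Stochastic Policy
Gradient Theorem (exact discrete-action case): with an auto-regressive joint policy
`π θ (a|s) = ∏ i, π_i (θ i) (a^i | s, a^{F_i})` where `F_i ⊆ {1,…,i−1}`, the objective
`J` is differentiable in each `θ_i` and
`∇_{θ_i} J(θ) = ∑ s, ρ^{π_θ}(s) ∑ a, ∇_{θ_i} π_i (a^i|s,a^{F_i}) ·
(∏_{j≠i} π_j (a^j|s,a^{F_j})) · Q(s,a)`; with discrete actions and no reparameterization
only this own-learning term remains. Conditional policies take the full joint action
but depend only on the coordinates in `F i`. -/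
theorem conditional_multiagent_policy_gradient_own_learning
    {S : Type*} [Fintype S] [Nonempty S] [DecidableEq S]
    {n : ℕ} (Ai : Fin n → Type*) [∀ i, Fintype (Ai i)] [∀ i, Nonempty (Ai i)]
    [∀ i, DecidableEq (Ai i)]
    (d : Fin n → ℕ)
    (P : S → (∀ i, Ai i) → S → ℝ)
    (hP0 : ∀ s a s', 0 ≤ P s a s')
    (hP1 : ∀ s a, ∑ s', P s a s' = 1)
    (r : S → (∀ i, Ai i) → ℝ)
    (γ : ℝ) (hγ0 : 0 ≤ γ) (hγ1 : γ < 1)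
    -- forward-dependency sets F_i ⊆ {1, …, i−1}
    (F : Fin n → Finset (Fin n))
    (hF : ∀ i, ∀ j ∈ F i, j < i)
    -- the individual conditional parameterized policies π_{θ_i}(·|s, a^{F_i})
    (πi : ∀ i, (Fin (d i) → ℝ) → S → (∀ j, Ai j) → Ai i → ℝ)
    (hdep : ∀ i x s (a a' : ∀ j, Ai j) b,
      (∀ j ∈ F i, a j = a' j) → πi i x s a b = πi i x s a' b)
    (hπ0 : ∀ i x s a b, 0 ≤ πi i x s a b)
    (hπ1 : ∀ i x s a, ∑ b, πi i x s a b = 1)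
    (hπC1 : ∀ i s a b, ContDiff ℝ 1 (fun x : Fin (d i) → ℝ => πi i x s a b))
    -- the t-step state distribution under the auto-regressive joint policy
    (T : (∀ i, Fin (d i) → ℝ) → ℕ → S → S → ℝ)
    (hT0 : ∀ θ s s', T θ 0 s s' = if s' = s then 1 else 0)
    (hTsucc : ∀ θ t s s'', T θ (t + 1) s s'' =
      ∑ s', T θ t s s' * ∑ a : ∀ i, Ai i, (∏ i, πi i (θ i) s' a (a i)) * P s' a s'')
    -- the value function V_{π_θ}
    (V : (∀ i, Fin (d i) → ℝ) → S → ℝ)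
    (hV : ∀ θ s, V θ s = ∑' t : ℕ, γ ^ t *
      ∑ s', T θ t s s' * ∑ a : ∀ i, Ai i, (∏ i, πi i (θ i) s' a (a i)) * r s' a)
    -- the action-value function Q_{π_θ}
    (Q : (∀ i, Fin (d i) → ℝ) → S → (∀ i, Ai i) → ℝ)
    (hQ : ∀ θ s a, Q θ s a = r s a + γ * ∑ s', P s a s' * V θ s')
    -- the initial state distribution ρ₀
    (ρ0 : S → ℝ) (hρ00 : ∀ s, 0 ≤ ρ0 s) (hρ01 : ∑ s, ρ0 s = 1)
    -- the discounted state distribution ρ^{π_θ}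
    (ρd : (∀ i, Fin (d i) → ℝ) → S → ℝ)
    (hρd : ∀ θ s, ρd θ s = ∑ s0, ρ0 s0 * ∑' t : ℕ, γ ^ t * T θ t s0 s)
    -- the objective J(θ)
    (J : (∀ i, Fin (d i) → ℝ) → ℝ)
    (hJ : ∀ θ, J θ = ∑ s, ρ0 s * V θ s)
    (θ : ∀ i, Fin (d i) → ℝ) (i : Fin n) :
    HasFDerivAt (fun x : Fin (d i) → ℝ => J (Function.update θ i x))
      (∑ s, ρd θ s • ∑ a : ∀ j, Ai j,
        ((∏ j ∈ Finset.univ.erase i, πi j (θ j) s a (a j)) * Q θ s a) •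
          fderiv ℝ (fun x : Fin (d i) → ℝ => πi i x s a (a i)) (θ i))
      (θ i) := by
  have hprod : ∀ x s (a : ∀ j, Ai j),
      ∏ j, πi j (Function.update θ i x j) s a (a j) =
        πi i x s a (a i) * ∏ j ∈ Finset.univ.erase i, πi j (θ j) s a (a j) := by
    intro x s a
    rw [← Finset.mul_prod_erase _ _ (Finset.mem_univ i), Function.update_self]
    congr 1
    refine Finset.prod_congr rfl fun j hj => ?_
    rw [Function.update_of_ne (Finset.ne_of_mem_erase hj)]
  have hgrad := hasFDerivAt_policy_objective P hP0 hP1 r γ hγ0 hγ1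
    (fun x s a => ∏ j, πi j (Function.update θ i x j) s a (a j))
    (fun x s a => Finset.prod_nonneg fun j _ => hπ0 _ _ _ _ _)
    (fun x s => sum_prod_conditional_eq_one Ai
      (fun j a b => πi j (Function.update θ i x j) s a b)
      (fun j a a' b h => hdep _ _ _ _ _ _ fun k hk => h k (hF j k hk))
      (fun j a => hπ1 _ _ _ _))
    (fun s a => by
      simp only [hprod]
      exact (hπC1 i s a (a i)).continuous.mul continuous_const)
    (fun x => T (Function.update θ i x)) (fun x => hT0 _) (fun x => hTsucc _)
    (fun x => V (Function.update θ i x)) (fun x => hV _) ρ0 (θ i)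
    (fun s a => (∏ j ∈ Finset.univ.erase i, πi j (θ j) s a (a j)) •
      fderiv ℝ (fun x : Fin (d i) → ℝ => πi i x s a (a i)) (θ i))
    (fun s a => by
      simp only [hprod]
      exact (((hπC1 i s a (a i)).differentiable one_ne_zero) (θ i)).hasFDerivAt.mul_const _)
  simp only [Function.update_eq_self, smul_smul, ← hQ, ← hρd, ← hJ] at hgrad
  simpa only [mul_comm (Q _ _ _)] using hgrad
end
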